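/- arXiv:2204.08690 — 2 statements merged into one kernel-verified Lean document; each statement's English description precedes it below -/
import Mathlib

section
/- Let X' ∼ Bin(m, p), let Δ ≤ m be a positive integer, and set X := min(X', Δ). Then for every real t with 0 < t·Δ ≤ 1/8 and 0 < t·m·p ≤ 1/16, E[e^{t·X²}] ≤ exp(16·t·m²·p² + 2·t·m·p). -/
open Finset

/-- The mean of `k * z ^ k` under the binomial distribution with `n + 1` trials. -/
lemma sum_binomial_mul_self_mul_pow (n : ℕ) (p z : ℝ) :
    ∑ k ∈ range (n + 1 + 1),
        ((n + 1).choose k : ℝ) * p ^ k * (1 - p) ^ (n + 1 - k) * (k * z ^ k)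
      = (n + 1) * p * z * (p * z + (1 - p)) ^ n := by
  rw [sum_range_succ', add_pow, mul_sum]
  simp only [Nat.cast_zero, zero_mul, mul_zero, add_zero]
  refine sum_congr rfl fun k _ => ?_
  have h : ((n + 1 : ℕ) : ℝ) * (n.choose k : ℝ)
      = ((n + 1).choose (k + 1) : ℝ) * ((k + 1 : ℕ) : ℝ) := by
    exact_mod_cast Nat.add_one_mul_choose_eq n k
  rw [Nat.add_sub_add_right, mul_pow]
  push_cast at h ⊢
  linear_combination (-(p ^ (k + 1) * (1 - p) ^ (n - k) * z ^ (k + 1))) * h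

lemma sum_binomial_eq_one (m : ℕ) (p : ℝ) :
    ∑ k ∈ range (m + 1), (m.choose k : ℝ) * p ^ k * (1 - p) ^ (m - k) = 1 := by
  have h := add_pow p (1 - p) m
  rw [add_sub_cancel, one_pow] at h
  exact (sum_congr rfl fun k _ => by ring).trans h.symm

lemma sum_binomial_mul_self_mul_exp_le {m : ℕ} (hm : 0 < m) {p s : ℝ} (hp0 : 0 ≤ p)
    (hs : 0 ≤ s) :
    ∑ k ∈ range (m + 1),
        (m.choose k : ℝ) * p ^ k * (1 - p) ^ (m - k) * (k * Real.exp (s * k))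
      ≤ m * p * Real.exp (s + m * p * (Real.exp s - 1)) := by
  obtain ⟨n, rfl⟩ := Nat.exists_eq_add_one.mpr hm
  have hz : 1 ≤ Real.exp s := Real.one_le_exp hs
  have hb : 1 ≤ p * Real.exp s + (1 - p) := by nlinarith
  have hpow : (p * Real.exp s + (1 - p)) ^ n
      ≤ Real.exp (((n + 1 : ℕ) : ℝ) * p * (Real.exp s - 1)) := by
    calc (p * Real.exp s + (1 - p)) ^ n
        ≤ (p * Real.exp s + (1 - p)) ^ (n + 1) := pow_le_pow_right₀ hb n.le_succ
      _ ≤ Real.exp (p * (Real.exp s - 1)) ^ (n + 1) := by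
          gcongr
          linarith [Real.add_one_le_exp (p * (Real.exp s - 1))]
      _ = _ := by rw [← Real.exp_nat_mul, mul_assoc]
  have hexp (k : ℕ) : Real.exp (s * k) = Real.exp s ^ k := by
    rw [← Real.exp_nat_mul, mul_comm]
  simp only [hexp]
  rw [sum_binomial_mul_self_mul_pow, Real.exp_add]
  push_cast at hpow ⊢
  rw [← mul_assoc]
  gcongr

/-- A pointwise bound `f k ≤ a * (1 + c * (k * exp (s * k)))` yields a bound on the mean of `f`
under the binomial distribution. -/
lemma sum_binomial_mul_le {m : ℕ} (hm : 0 < m) {p s a c : ℝ} (hp0 : 0 ≤ p) (hp1 : p ≤ 1)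
    (hs : 0 ≤ s) (ha : 0 ≤ a) (hc : 0 ≤ c) {f : ℕ → ℝ}
    (hf : ∀ k : ℕ, f k ≤ a * (1 + c * (k * Real.exp (s * k)))) :
    ∑ k ∈ range (m + 1), (m.choose k : ℝ) * p ^ k * (1 - p) ^ (m - k) * f k
      ≤ a * (1 + c * (m * p * Real.exp (s + m * p * (Real.exp s - 1)))) := by
  have hq : 0 ≤ 1 - p := sub_nonneg.mpr hp1
  calc ∑ k ∈ range (m + 1), (m.choose k : ℝ) * p ^ k * (1 - p) ^ (m - k) * f k
      ≤ ∑ k ∈ range (m + 1), (m.choose k : ℝ) * p ^ k * (1 - p) ^ (m - k) *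
          (a * (1 + c * (k * Real.exp (s * k)))) := by
        gcongr with k _
        exact hf k
    _ = a * (∑ k ∈ range (m + 1), (m.choose k : ℝ) * p ^ k * (1 - p) ^ (m - k) +
          c * ∑ k ∈ range (m + 1),
            (m.choose k : ℝ) * p ^ k * (1 - p) ^ (m - k) * (k * Real.exp (s * k))) := by
        rw [mul_sum, ← sum_add_distrib, mul_sum]
        exact sum_congr rfl fun k _ => by ring
    _ ≤ _ := by
        rw [sum_binomial_eq_one]
        gcongr
        exact sum_binomial_mul_self_mul_exp_le hm hp0 hs

lemma exp_le_one_add_mul_exp (y : ℝ) : Real.exp y ≤ 1 + y * Real.exp y := by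
  have h := mul_le_mul_of_nonneg_right (Real.add_one_le_exp (-y)) (Real.exp_pos y).le
  rw [← Real.exp_add, neg_add_cancel, Real.exp_zero] at h
  linarith

lemma mul_exp_div_eight_le (x : ℝ) :
    x * Real.exp (x / 8) ≤ 8 / 3 * Real.exp (-1) * Real.exp (x / 2) := by
  have h := mul_le_mul_of_nonneg_right (Real.add_one_le_exp (3 * x / 8 - 1))
    (Real.exp_pos (x / 8)).le
  rw [← Real.exp_add] at h
  rw [mul_assoc, ← Real.exp_add]
  ring_nf at h ⊢
  linarith

/-- The exponential of the truncated square exceeds the threshold value `exp (t * r ^ 2)` only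
when `r < k`, and then by a controlled amount. -/
lemma exp_mul_min_sq_le {t r : ℝ} {Δ : ℕ} (ht : 0 ≤ t) (htΔ : t * Δ ≤ 1 / 8) (k : ℕ) :
    Real.exp (t * ((min k Δ : ℕ) : ℝ) ^ 2) ≤ Real.exp (t * r ^ 2) *
      (1 + if r < k then t * (8 / 3 * Real.exp (-1)) * (k * Real.exp (k / 2)) else 0) := by
  set x : ℝ := ((min k Δ : ℕ) : ℝ) with hx
  have hx0 : 0 ≤ x := Nat.cast_nonneg _
  have hxk : x ≤ k := Nat.cast_le.mpr (min_le_left _ _)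
  have hxΔ : x ≤ Δ := Nat.cast_le.mpr (min_le_right _ _)
  rcases le_or_gt x r with h | h
  · have hle : Real.exp (t * x ^ 2) ≤ Real.exp (t * r ^ 2) := by gcongr
    refine hle.trans (le_mul_of_one_le_right (Real.exp_pos _).le ?_)
    split_ifs
    · exact le_add_of_nonneg_right (by positivity)
    · simp
  · rw [if_pos (h.trans_le hxk)]
    have hsplit : Real.exp (t * x ^ 2)
        = Real.exp (t * r ^ 2) * Real.exp (t * x ^ 2 - t * r ^ 2) := by
      rw [← Real.exp_add]
      ring_nf
    rw [hsplit]
    gcongr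
    refine (exp_le_one_add_mul_exp _).trans ?_
    have htx : t * x ≤ 1 / 8 := (mul_le_mul_of_nonneg_left hxΔ ht).trans htΔ
    have hle : t * x ^ 2 - t * r ^ 2 ≤ t * k ^ 2 :=
      (sub_le_self _ (by positivity)).trans (by gcongr)
    have hle' : t * x ^ 2 - t * r ^ 2 ≤ k / 8 := by
      nlinarith [mul_nonneg ht (sq_nonneg r), mul_le_mul_of_nonneg_right htx hx0]
    calc 1 + (t * x ^ 2 - t * r ^ 2) * Real.exp (t * x ^ 2 - t * r ^ 2)
        ≤ 1 + t * k ^ 2 * Real.exp (k / 8) := by gcongr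
      _ = 1 + t * k * (k * Real.exp (k / 8)) := by ring
      _ ≤ 1 + t * k * (8 / 3 * Real.exp (-1) * Real.exp (k / 2)) := by
          exact add_le_add_right
            (mul_le_mul_of_nonneg_left (mul_exp_div_eight_le _) (by positivity)) _
      _ = _ := by ring

/-- The exponent comparison for a binomial mean `u` at most `2`. -/
lemma exp_tilt_half_le {u : ℝ} (hu0 : 0 ≤ u) (hu2 : u ≤ 2) :
    8 / 3 * Real.exp (-1) * Real.exp (1 / 2 + u * (Real.exp (1 / 2) - 1)) ≤ 2 + 16 * u := by
  have he := Real.exp_one_lt_d9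
  have hsq : Real.exp (1 / 2) * Real.exp (1 / 2) = Real.exp 1 := by
    rw [← Real.exp_add]; norm_num
  have hlo : 3 / 2 ≤ Real.exp (1 / 2) := by linarith [Real.add_one_le_exp (1 / 2 : ℝ)]
  have hhi : Real.exp (1 / 2) ≤ 5 / 3 := by nlinarith
  have hinv : Real.exp (-1) * Real.exp (1 / 2) ≤ 3 / 4 := by
    have h : Real.exp (-1) * Real.exp (1 / 2) * Real.exp (1 / 2) = 1 := by
      rw [mul_assoc, hsq, ← Real.exp_add]; norm_num
    nlinarith [mul_pos (Real.exp_pos (-1)) (Real.exp_pos (1 / 2))]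
  have he2 : Real.exp 2 ≤ 8 := by
    have h : Real.exp 2 = Real.exp 1 * Real.exp 1 := by rw [← Real.exp_add]; norm_num
    nlinarith [Real.exp_pos 1]
  have hgrow : Real.exp (u * (Real.exp (1 / 2) - 1)) ≤ 1 + 6 * u := by
    calc Real.exp (u * (Real.exp (1 / 2) - 1)) ≤ Real.exp (2 / 3 * u) := by
          refine Real.exp_le_exp.mpr ?_
          nlinarith
      _ ≤ 1 + 2 / 3 * u * Real.exp (2 / 3 * u) := exp_le_one_add_mul_exp _
      _ ≤ 1 + 2 / 3 * u * 8 := by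
          gcongr
          exact (Real.exp_le_exp.mpr (by linarith)).trans he2
      _ ≤ 1 + 6 * u := by linarith
  calc 8 / 3 * Real.exp (-1) * Real.exp (1 / 2 + u * (Real.exp (1 / 2) - 1))
      = 8 / 3 * (Real.exp (-1) * Real.exp (1 / 2)) * Real.exp (u * (Real.exp (1 / 2) - 1)) := by
        rw [Real.exp_add]; ring
    _ ≤ 8 / 3 * (3 / 4) * (1 + 6 * u) := by gcongr
    _ ≤ 2 + 16 * u := by linarith

/-- The exponent comparison for a binomial mean `u` at least `2`. -/
lemma exp_tilt_one_le {u : ℝ} (hu : 2 ≤ u) :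
    8 / 3 * Real.exp (-1) * Real.exp (-(2 * u)) * Real.exp (1 + u * (Real.exp 1 - 1)) ≤ 2 := by
  have he := Real.exp_one_lt_d9
  have h1 : 8 / 3 * Real.exp (-1) * Real.exp (-(2 * u)) * Real.exp (1 + u * (Real.exp 1 - 1))
      = 8 / 3 * Real.exp (u * (Real.exp 1 - 3)) := by
    rw [mul_assoc, mul_assoc, ← Real.exp_add, ← Real.exp_add]
    ring_nf
  have h2 : Real.exp (u * (Real.exp 1 - 3)) ≤ Real.exp (-(1 / 2)) := by
    gcongr
    nlinarith
  have h3 : Real.exp (-(1 / 2)) * Real.exp (1 / 2) = 1 := by rw [← Real.exp_add]; norm_num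
  have h4 : 3 / 2 ≤ Real.exp (1 / 2) := by linarith [Real.add_one_le_exp (1 / 2 : ℝ)]
  rw [h1]
  nlinarith [Real.exp_pos (-(1 / 2) : ℝ)]

/-- MGF bound for the square of a truncated binomial: if `X' ∼ Bin(m, p)`,
`X = min(X', Δ)` with `0 < Δ ≤ m`, `0 < t·Δ ≤ 1/8` and `0 < t·m·p ≤ 1/16`, then
`E[e^{t X²}] ≤ exp(16·t·m²·p² + 2·t·m·p)`. -/
theorem truncated_binomial_square_mgf_bound
    (m Δ : ℕ) (hΔ0 : 0 < Δ) (hΔm : Δ ≤ m)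
    (p t : ℝ) (hp1 : p ≤ 1)
    (htΔ0 : 0 < t * (Δ : ℝ)) (htΔ1 : t * (Δ : ℝ) ≤ 1 / 8)
    (htmp0 : 0 < t * (m : ℝ) * p) (htmp1 : t * (m : ℝ) * p ≤ 1 / 16) :
    ∑ k ∈ Finset.range (m + 1),
        (m.choose k : ℝ) * p ^ k * (1 - p) ^ (m - k) *
          Real.exp (t * ((min k Δ : ℕ) : ℝ) ^ 2)
      ≤ Real.exp (16 * t * (m : ℝ) ^ 2 * p ^ 2 + 2 * t * m * p) := by
  have ht : 0 < t := pos_of_mul_pos_left htΔ0 (Nat.cast_nonneg _)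
  have hm : 0 < m := hΔ0.trans_le hΔm
  have hp : 0 < p := pos_of_mul_pos_right htmp0 (by positivity)
  set u : ℝ := m * p with hu
  have hu0 : 0 ≤ u := by positivity
  rcases le_total u 2 with h2 | h2
  · refine (sum_binomial_mul_le hm (s := 1 / 2) (a := 1)
      (c := t * (8 / 3 * Real.exp (-1))) hp.le hp1 (by norm_num) zero_le_one (by positivity)
      fun k => ?_).trans ?_
    · refine (exp_mul_min_sq_le ht.le htΔ1 (r := 0) k).trans ?_
      rw [one_div_mul_eq_div]
      split_ifs
      · simp
      · simp only [zero_pow two_ne_zero, mul_zero, Real.exp_zero, add_zero, one_mul]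
        exact le_add_of_nonneg_right (by positivity)
    · calc 1 * (1 + t * (8 / 3 * Real.exp (-1)) *
            (u * Real.exp (1 / 2 + u * (Real.exp (1 / 2) - 1))))
          = t * u * (8 / 3 * Real.exp (-1) *
              Real.exp (1 / 2 + u * (Real.exp (1 / 2) - 1))) + 1 := by ring
        _ ≤ t * u * (2 + 16 * u) + 1 := by
            gcongr
            exact exp_tilt_half_le hu0 h2
        _ ≤ Real.exp (t * u * (2 + 16 * u)) := Real.add_one_le_exp _
        _ = _ := by
            rw [hu]
            ring_nf
  · refine (sum_binomial_mul_le hm (s := 1) (a := Real.exp (t * (4 * u) ^ 2))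
      (c := t * (8 / 3 * Real.exp (-1) * Real.exp (-(2 * u)))) hp.le hp1 zero_le_one
      (Real.exp_pos _).le (by positivity) fun k => ?_).trans ?_
    · refine (exp_mul_min_sq_le ht.le htΔ1 (r := 4 * u) k).trans ?_
      gcongr
      split_ifs with hk
      · have hexp : Real.exp (k / 2) ≤ Real.exp (-(2 * u)) * Real.exp (1 * k) := by
          rw [← Real.exp_add]
          gcongr
          linarith
        calc t * (8 / 3 * Real.exp (-1)) * (k * Real.exp (k / 2))
            ≤ t * (8 / 3 * Real.exp (-1)) *
                (k * (Real.exp (-(2 * u)) * Real.exp (1 * k))) := by gcongr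
          _ = _ := by ring
      · positivity
    · calc Real.exp (t * (4 * u) ^ 2) * (1 + t * (8 / 3 * Real.exp (-1) * Real.exp (-(2 * u))) *
            (u * Real.exp (1 + u * (Real.exp 1 - 1))))
          = Real.exp (t * (4 * u) ^ 2) * (t * u * (8 / 3 * Real.exp (-1) * Real.exp (-(2 * u)) *
              Real.exp (1 + u * (Real.exp 1 - 1))) + 1) := by ring
        _ ≤ Real.exp (t * (4 * u) ^ 2) * (t * u * 2 + 1) := by
            gcongr
            exact exp_tilt_one_le h2
        _ ≤ Real.exp (t * (4 * u) ^ 2) * Real.exp (t * u * 2) := by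
            gcongr
            exact Real.add_one_le_exp _
        _ = _ := by
            rw [← Real.exp_add, hu]
            ring_nf
end

section
/- Let R be a nonnegative-integer-valued random variable satisfying Pr[R ≥ k] ≤ 1/k! for every integer k ≥ 1. Then for every α > 0: E[e^{α·R}] ≤ 1 + (1 − e^{−α})·(e^{e^{α}} − 1). -/
open Finset

/-- A power as a geometric sum of smaller positive powers. -/
lemma pow_eq_one_add_mul_geom_sum {x : ℝ} (hx : x ≠ 0) (k : ℕ) :
    x ^ k = 1 + (1 - x⁻¹) * ∑ i ∈ range k, x ^ (i + 1) := by
  induction k with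
  | zero => simp
  | succ k ih =>
    rw [sum_range_succ, mul_add, ← add_assoc, ← ih, pow_succ]
    field_simp
    ring

/-- Summation by parts: a truncated moment sum in terms of truncated tails. -/
lemma sum_mul_pow_eq_tail_sum (f : ℕ → ℝ) {x : ℝ} (hx : x ≠ 0) (n : ℕ) :
    ∑ k ∈ range n, f k * x ^ k = ∑ k ∈ range n, f k +
      (1 - x⁻¹) * ∑ i ∈ range n, x ^ (i + 1) * ∑ k ∈ range n, if i + 1 ≤ k then f k else 0 := by
  have hpow : ∀ k ∈ range n, f k * x ^ k = f k +
      (1 - x⁻¹) * ∑ i ∈ range n, x ^ (i + 1) * if i + 1 ≤ k then f k else 0 := by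
    intro k hk
    have hfilter : (range n).filter (fun i => i + 1 ≤ k) = range k := by
      ext i
      simp only [mem_filter, mem_range] at hk ⊢
      omega
    simp only [mul_ite, mul_zero]
    rw [← sum_filter, hfilter, ← sum_mul, pow_eq_one_add_mul_geom_sum hx k]
    ring
  rw [sum_congr rfl hpow, sum_add_distrib, ← mul_sum, sum_comm]
  simp only [mul_sum]

/-- MGF bound from factorial tail decay: if `R` is a nonnegative-integer-valued random
variable (with pmf `f`) satisfying `Pr[R ≥ k] ≤ 1/k!` for every `k ≥ 1`, then for every
`α > 0`, `E[e^{αR}] ≤ 1 + (1 − e^{−α})·(e^{e^α} − 1)`. -/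
theorem mgf_bound_from_factorial_tails
    (f : ℕ → ℝ) (hf0 : ∀ k, 0 ≤ f k) (hf1 : ∑' k : ℕ, f k = 1)
    (htail : ∀ k : ℕ, 1 ≤ k →
      (∑' j : ℕ, if k ≤ j then f j else 0) ≤ 1 / (Nat.factorial k : ℝ))
    (α : ℝ) (hα : 0 < α) :
    ∑' k : ℕ, f k * Real.exp (α * k)
      ≤ 1 + (1 - Real.exp (-α)) * (Real.exp (Real.exp α) - 1) := by
  have hf : Summable f := by
    by_contra h
    simp [tsum_eq_zero_of_not_summable h] at hf1
  have hite : ∀ k j : ℕ, 0 ≤ if k ≤ j then f j else 0 := fun k j => by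
    split_ifs
    exacts [hf0 j, le_rfl]
  have htail_summable : ∀ k : ℕ, Summable fun j => if k ≤ j then f j else 0 := fun k =>
    Summable.of_nonneg_of_le (hite k) (fun j => by split_ifs; exacts [le_rfl, hf0 j]) hf
  refine Real.tsum_le_of_sum_range_le
    (fun k => mul_nonneg (hf0 k) (Real.exp_pos _).le) fun n => ?_
  have hexp : ∀ k : ℕ, Real.exp (α * k) = Real.exp α ^ k := fun k => by
    rw [mul_comm, Real.exp_nat_mul]
  simp only [hexp]
  rw [sum_mul_pow_eq_tail_sum f (Real.exp_pos α).ne', ← Real.exp_neg]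
  refine add_le_add (hf1 ▸ hf.sum_le_tsum _ fun k _ => hf0 k)
    (mul_le_mul_of_nonneg_left ?_ ?_)
  · calc ∑ i ∈ range n, Real.exp α ^ (i + 1) * ∑ k ∈ range n, (if i + 1 ≤ k then f k else 0)
        ≤ ∑ i ∈ range n, Real.exp α ^ (i + 1) / (Nat.factorial (i + 1) : ℝ) := by
          refine sum_le_sum fun i _ => ?_
          rw [div_eq_mul_one_div]
          exact mul_le_mul_of_nonneg_left
            (((htail_summable (i + 1)).sum_le_tsum _ fun k _ => hite (i + 1) k).trans
              (htail (i + 1) (Nat.le_add_left 1 i)))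
            (by positivity)
      _ ≤ Real.exp (Real.exp α) - 1 := by
          have h := Real.sum_le_exp_of_nonneg (Real.exp_pos α).le (n + 1)
          rw [sum_range_succ'] at h
          simp only [pow_zero, Nat.factorial_zero, Nat.cast_one, div_one] at h
          linarith
  · have : Real.exp (-α) ≤ 1 := Real.exp_le_one_iff.mpr (by linarith)
    linarith
end
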